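/- arXiv:1702.00304 — 4 statements merged into one kernel-verified Lean document; each statement's English description precedes it below -/
import Mathlib

section
/- Let M=(Q,Σ,μ,F) be a wta over the commutative semifield S and let λ: Q → S∖{0} satisfy λ(q)=1 for every q∈F. Then the pushed wta push_λ(M) is equivalent to M, i.e., push_λ(M)(t) = M(t) for every tree t∈T_Σ. -/
open scoped BigOperators Classical

namespace WTA

/-- Trees over a ranked alphabet `Sig` (with arity map `ar`), indexed by states `Q`. -/
inductive PTree (Sig : Type) (ar : Sig → ℕ) (Q : Type) : Type where
  | state : Q → PTree Sig ar Q
  | node : (s : Sig) → (Fin (ar s) → PTree Sig ar Q) → PTree Sig ar Q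

/-- Contexts: trees with exactly one occurrence of the hole `□` at a leaf. -/
inductive Ctx (Sig : Type) (ar : Sig → ℕ) (Q : Type) : Type where
  | hole : Ctx Sig ar Q
  | node : (s : Sig) → (i : Fin (ar s)) → (Fin (ar s) → PTree Sig ar Q) →
      Ctx Sig ar Q → Ctx Sig ar Q

variable {Sig Q Q' S : Type} {ar : Sig → ℕ}

/-- Substitution `c[t]` of a tree into the hole of a context. -/
def Ctx.subst : Ctx Sig ar Q → PTree Sig ar Q → PTree Sig ar Q
  | .hole, t => t
  | .node s i ts c, t => .node s (Function.update ts i (c.subst t))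

/-- A closed tree (over `T_Σ`) viewed as a tree indexed by `Q`. -/
def PTree.ofClosed : PTree Sig ar Empty → PTree Sig ar Q
  | .state e => e.elim
  | .node s ts => .node s fun i => (ts i).ofClosed

/-- A closed context viewed as a context with states in `Q`. -/
def Ctx.ofClosed : Ctx Sig ar Empty → Ctx Sig ar Q
  | .hole => .hole
  | .node s i ts c => .node s i (fun j => (ts j).ofClosed) c.ofClosed

/-- Renaming of the states occurring in a tree. -/
def PTree.rename (g : Q → Q') : PTree Sig ar Q → PTree Sig ar Q'
  | .state p => .state (g p)
  | .node s ts => .node s fun i => (ts i).rename g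

/-- Renaming of the states occurring in a context. -/
def Ctx.rename (g : Q → Q') : Ctx Sig ar Q → Ctx Sig ar Q'
  | .hole => .hole
  | .node s i ts c => .node s i (fun j => (ts j).rename g) (c.rename g)

/-- The extension `h_μ` of the transition weight assignment `μ` to trees:
`h_μ(t → q)`. -/
noncomputable def hmu [Fintype Q] [CommSemiring S]
    (μ : ∀ s : Sig, (Fin (ar s) → Q) → Q → S) : PTree Sig ar Q → Q → S
  | .state p, q => if p = q then 1 else 0
  | .node s ts, q => ∑ qs : Fin (ar s) → Q, μ s qs q * ∏ i, hmu μ (ts i) (qs i)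

/-- The weighted tree language recognized by the wta `(Q, Σ, μ, F)`:
`M(t) = Σ_{q ∈ F} h_μ(t → q)`. -/
noncomputable def wtaSem [Fintype Q] [CommSemiring S]
    (μ : ∀ s : Sig, (Fin (ar s) → Q) → Q → S) (F : Finset Q)
    (t : PTree Sig ar Empty) : S :=
  ∑ q ∈ F, hmu μ (PTree.ofClosed t) q

/-- Bottom-up determinism: every left-hand side `σ(q₁,…,q_k)` has at most one
target state with nonzero weight. -/
def Deterministic [CommSemiring S] (μ : ∀ s : Sig, (Fin (ar s) → Q) → Q → S) : Prop :=
  ∀ (s : Sig) (qs : Fin (ar s) → Q) (q q' : Q), μ s qs q ≠ 0 → μ s qs q' ≠ 0 → q = q'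

/-- The pushed transition weight assignment
`μ'(σ(q₁,…,q_k) → q) = λ(q) · μ(σ(q₁,…,q_k) → q) · ∏ᵢ λ(qᵢ)⁻¹`. -/
noncomputable def push [Fintype Q] [Semifield S] (lam : Q → S)
    (μ : ∀ s : Sig, (Fin (ar s) → Q) → Q → S) :
    ∀ s : Sig, (Fin (ar s) → Q) → Q → S :=
  fun s qs q => lam q * μ s qs q * ∏ i, (lam (qs i))⁻¹

/-- `h_μ^{(1)}(t) ∈ F` (for a deterministic wta): some final state is reached
with nonzero weight. -/
def finReach [Fintype Q] [CommSemiring S]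
    (μ : ∀ s : Sig, (Fin (ar s) → Q) → Q → S) (F : Finset Q)
    (t : PTree Sig ar Q) : Prop :=
  ∃ q ∈ F, hmu μ t q ≠ 0

/-- `h_μ^{(2)}(t) · χ_F(h_μ^{(1)}(t))` (for a deterministic wta); an undefined
value counts as `0`. -/
noncomputable def cweight [Fintype Q] [CommSemiring S]
    (μ : ∀ s : Sig, (Fin (ar s) → Q) → Q → S) (F : Finset Q)
    (t : PTree Sig ar Q) : S :=
  ∑ q ∈ F, hmu μ t q

/-- `h_μ^{(2)}(t)` (for a deterministic wta); an undefined value counts as `0`. -/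
noncomputable def tweight [Fintype Q] [CommSemiring S]
    (μ : ∀ s : Sig, (Fin (ar s) → Q) → Q → S) (t : PTree Sig ar Q) : S :=
  ∑ q, hmu μ t q

/-- A context `c` is a sign of life for the state `q` if `h_μ^{(1)}(c[q]) ∈ F`. -/
def SignOfLife [Fintype Q] [CommSemiring S]
    (μ : ∀ s : Sig, (Fin (ar s) → Q) → Q → S) (F : Finset Q)
    (c : Ctx Sig ar Q) (q : Q) : Prop :=
  finReach μ F (c.subst (.state q))

/-- A state is live if it has a sign of life. -/
def Live [Fintype Q] [CommSemiring S]
    (μ : ∀ s : Sig, (Fin (ar s) → Q) → Q → S) (F : Finset Q) (q : Q) : Prop :=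
  ∃ c : Ctx Sig ar Q, SignOfLife μ F c q

/-- Weak equivalence `q₁ ∼_M q₂`. -/
def WeakEquiv [Fintype Q] [CommSemiring S]
    (μ : ∀ s : Sig, (Fin (ar s) → Q) → Q → S) (F : Finset Q)
    (q₁ q₂ : Q) : Prop :=
  ∀ c : Ctx Sig ar Q,
    finReach μ F (c.subst (.state q₁)) ↔ finReach μ F (c.subst (.state q₂))

/-- Myhill–Nerode equivalence `q₁ ≡_M q₂`: there is a nonzero factor `s` with
`h_μ^{(2)}(c[q₁])·χ_F(h_μ^{(1)}(c[q₁])) = s · h_μ^{(2)}(c[q₂])·χ_F(h_μ^{(1)}(c[q₂]))`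
for all contexts `c`. -/
def MNEquiv [Fintype Q] [CommSemiring S]
    (μ : ∀ s : Sig, (Fin (ar s) → Q) → Q → S) (F : Finset Q)
    (q₁ q₂ : Q) : Prop :=
  ∃ s : S, s ≠ 0 ∧ ∀ c : Ctx Sig ar Q,
    cweight μ F (c.subst (.state q₁)) = s * cweight μ F (c.subst (.state q₂))

/-- `r` is a congruence of the dwta: equivalent left-hand sides have equivalent
targets (`μ^{(1)}`-values), where two undefined values are regarded as
equivalent and an undefined value is never equivalent to a defined one. -/
def IsCongruence [Fintype Q] [CommSemiring S]
    (μ : ∀ s : Sig, (Fin (ar s) → Q) → Q → S) (r : Q → Q → Prop) : Prop :=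
  ∀ (s : Sig) (qs qs' : Fin (ar s) → Q), (∀ i, r (qs i) (qs' i)) →
    ((∃ q, μ s qs q ≠ 0) ↔ (∃ q, μ s qs' q ≠ 0)) ∧
    (∀ q q', μ s qs q ≠ 0 → μ s qs' q' ≠ 0 → r q q')

/-- `r` respects `F`: every class lies inside `F` or outside `F`. -/
def Respects (r : Q → Q → Prop) (F : Finset Q) : Prop :=
  ∀ q q', r q q' → (q ∈ F ↔ q' ∈ F)

/-- Accessibility: every state is reached by some (closed) tree. -/
def Accessible [Fintype Q] [CommSemiring S]
    (μ : ∀ s : Sig, (Fin (ar s) → Q) → Q → S) : Prop :=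
  ∀ q : Q, ∃ t : PTree Sig ar Empty, hmu μ (PTree.ofClosed t) q ≠ 0

/-- The transition weight assignment of the alphabetic dwta `syn(N)` over the
ranked alphabet `Σ × S` (where `⟨σ, s⟩` has the rank of `σ`):
`ν''(⟨σ,s⟩(q₁,…,q_k) → q) = 1` iff `ν(σ(q₁,…,q_k) → q) = s ≠ 0`. -/
noncomputable def synMu [Fintype Q] [CommSemiring S]
    (ν : ∀ s : Sig, (Fin (ar s) → Q) → Q → S) :
    ∀ p : Sig × S, (Fin ((fun p : Sig × S => ar p.1) p) → Q) → Q → S :=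
  fun p qs q => if ν p.1 qs q = p.2 ∧ p.2 ≠ 0 then 1 else 0

/-- Runs of the unweighted tree automaton `unw(M)` with transitions `supp(μ)`:
`Reach μ t q` iff `unw(M)` can reach state `q` on the tree `t`. -/
inductive Reach [CommSemiring S] (μ : ∀ s : Sig, (Fin (ar s) → Q) → Q → S) :
    PTree Sig ar Q → Q → Prop where
  | state (q : Q) : Reach μ (.state q) q
  | node {s : Sig} (ts : Fin (ar s) → PTree Sig ar Q) (qs : Fin (ar s) → Q) (q : Q)
      (h : μ s qs q ≠ 0) (hc : ∀ i, Reach μ (ts i) (qs i)) : Reach μ (.node s ts) q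

/-- On closed trees, pushing scales the weight of reaching `q` by `λ(q)`. -/
theorem hmu_push_ofClosed [Fintype Q] [Semifield S]
    (μ : ∀ s : Sig, (Fin (ar s) → Q) → Q → S) (lam : Q → S) (hlam₀ : ∀ q : Q, lam q ≠ 0)
    (t : PTree Sig ar Empty) (q : Q) :
    hmu (push lam μ) t.ofClosed q = lam q * hmu μ t.ofClosed q := by
  induction t generalizing q with
  | state e => exact e.elim
  | node s ts ih =>
    simp only [PTree.ofClosed, hmu, push, ih, Finset.mul_sum]
    refine Finset.sum_congr rfl fun qs _ => ?_
    have h : (∏ i, (lam (qs i))⁻¹) * ∏ i, lam (qs i) = 1 := by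
      rw [← Finset.prod_mul_distrib]
      exact Finset.prod_eq_one fun i _ => inv_mul_cancel₀ (hlam₀ _)
    rw [Finset.prod_mul_distrib, mul_assoc (lam q * μ s qs q), ← mul_assoc (∏ i, _), h,
      one_mul, mul_assoc]

/-- Pushing preserves the recognized weighted tree language:
`push_λ(M)(t) = M(t)` for every `t ∈ T_Σ`. -/
theorem pushed_wta_equivalent {Sig Q S : Type} {ar : Sig → ℕ}
    [Fintype Q] [Semifield S]
    (μ : ∀ s : Sig, (Fin (ar s) → Q) → Q → S) (F : Finset Q)
    (lam : Q → S) (hlam₀ : ∀ q : Q, lam q ≠ 0) (hlamF : ∀ q ∈ F, lam q = 1) :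
    ∀ t : PTree Sig ar Empty, wtaSem (push lam μ) F t = wtaSem μ F t := by
  intro t
  refine Finset.sum_congr rfl fun q hq => ?_
  rw [hmu_push_ofClosed μ lam hlam₀, hlamF q hq, one_mul]

end WTA
end

section
/- Let M=(Q,Σ,μ,F) be a wta over the commutative semifield S, let λ: Q → S∖{0} satisfy λ(q)=1 for every q∈F, and let μ' be the transition weight assignment of push_λ(M). Then h_{μ'}(t→q) = λ(q)·h_μ(t→q) for every t∈T_Σ and every q∈Q. -/
open scoped BigOperators Classical

namespace WTA

variable {Sig Q Q' S : Type} {ar : Sig → ℕ}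

/-- `h_{μ'}(t → q) = λ(q) · h_μ(t → q)` for every `t ∈ T_Σ`
and `q ∈ Q`, where `μ'` is the transition weight assignment of `push_λ(M)`. -/
theorem pushed_hmu_eq {Sig Q S : Type} {ar : Sig → ℕ}
    [Fintype Q] [Semifield S]
    (μ : ∀ s : Sig, (Fin (ar s) → Q) → Q → S) (F : Finset Q)
    (lam : Q → S) (hlam₀ : ∀ q : Q, lam q ≠ 0) (hlamF : ∀ q ∈ F, lam q = 1) :
    ∀ (t : PTree Sig ar Empty) (q : Q),
      hmu (push lam μ) (PTree.ofClosed t) q = lam q * hmu μ (PTree.ofClosed t) q := by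
  intro t
  induction t with
  | state e => exact e.elim
  | node s ts ih =>
    intro q
    simp only [PTree.ofClosed, hmu, push, ih, Finset.mul_sum, Finset.prod_mul_distrib,
      Finset.prod_inv_distrib]
    refine Finset.sum_congr rfl fun qs _ => ?_
    have hprod : ∏ i, lam (qs i) ≠ 0 := Finset.prod_ne_zero_iff.mpr fun i _ => hlam₀ (qs i)
    rw [mul_assoc, inv_mul_cancel_left₀ hprod, mul_assoc]

end WTA
end

section
/- Let M=(Q,Σ,μ,F) be a dwta over the commutative semifield S. If ≅ is a congruence of M that respects F, then ≅ is contained in the weak equivalence ∼_M, i.e., q ≅ q' implies q ∼_M q' for all q,q'∈Q. -/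
open scoped BigOperators Classical

namespace WTA

variable {Sig Q Q' S : Type} {ar : Sig → ℕ}

theorem exists_of_hmu_node_ne_zero [Fintype Q] [CommSemiring S]
    {μ : ∀ s : Sig, (Fin (ar s) → Q) → Q → S} {s : Sig}
    {ts : Fin (ar s) → PTree Sig ar Q} {q : Q} (h : hmu μ (.node s ts) q ≠ 0) :
    ∃ qs : Fin (ar s) → Q, μ s qs q ≠ 0 ∧ ∀ i, hmu μ (ts i) (qs i) ≠ 0 := by
  rw [hmu] at h
  obtain ⟨qs, -, hqs⟩ := Finset.exists_ne_zero_of_sum_ne_zero h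
  refine ⟨qs, left_ne_zero_of_mul hqs, fun i hi => right_ne_zero_of_mul hqs ?_⟩
  exact Finset.prod_eq_zero (Finset.mem_univ i) hi

/-- In a deterministic wta every tree reaches at most one state with nonzero weight. -/
theorem Deterministic.hmu_unique [Fintype Q] [CommSemiring S]
    {μ : ∀ s : Sig, (Fin (ar s) → Q) → Q → S} (hdet : Deterministic μ)
    (t : PTree Sig ar Q) :
    ∀ {q q' : Q}, hmu μ t q ≠ 0 → hmu μ t q' ≠ 0 → q = q' := by
  induction t with
  | state p =>
    intro q q' h h'
    simp only [hmu, ne_eq, ite_eq_right_iff, not_forall] at h h'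
    exact h.1.symm.trans h'.1
  | node s ts ih =>
    intro q q' h h'
    obtain ⟨qs, hq, hqs⟩ := exists_of_hmu_node_ne_zero h
    obtain ⟨qs', hq', hqs'⟩ := exists_of_hmu_node_ne_zero h'
    obtain rfl : qs = qs' := funext fun i => ih i (hqs i) (hqs' i)
    exact hdet s qs q q' hq hq'

theorem Deterministic.hmu_node_ne_zero [Fintype Q] [Semifield S]
    {μ : ∀ s : Sig, (Fin (ar s) → Q) → Q → S} (hdet : Deterministic μ) {s : Sig}
    {ts : Fin (ar s) → PTree Sig ar Q} {qs : Fin (ar s) → Q} {q : Q}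
    (hq : μ s qs q ≠ 0) (hqs : ∀ i, hmu μ (ts i) (qs i) ≠ 0) :
    hmu μ (.node s ts) q ≠ 0 := by
  rw [hmu, Finset.sum_eq_single qs]
  · exact mul_ne_zero hq (Finset.prod_ne_zero_iff.2 fun i _ => hqs i)
  · intro qs' _ hne
    by_contra h
    refine hne (funext fun i => hdet.hmu_unique (ts i) (fun hi => ?_) (hqs i))
    exact right_ne_zero_of_mul h (Finset.prod_eq_zero (Finset.mem_univ i) hi)
  · exact fun h => absurd (Finset.mem_univ qs) h

/-- Substituting congruent states into a context leads to congruent states. -/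
theorem IsCongruence.exists_hmu_subst_ne_zero [Fintype Q] [Semifield S]
    {μ : ∀ s : Sig, (Fin (ar s) → Q) → Q → S} {r : Q → Q → Prop}
    (hcong : IsCongruence μ r) (hdet : Deterministic μ) (hrefl : ∀ q, r q q)
    {q q' : Q} (hr : r q q') (c : Ctx Sig ar Q) :
    ∀ {p : Q}, hmu μ (c.subst (.state q)) p ≠ 0 →
      ∃ p', r p p' ∧ hmu μ (c.subst (.state q')) p' ≠ 0 := by
  induction c with
  | hole =>
    intro p hp
    simp only [Ctx.subst, hmu, ne_eq, ite_eq_right_iff, not_forall] at hp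
    obtain ⟨rfl, -⟩ := hp
    exact ⟨q', hr, by simp [Ctx.subst, hmu]⟩
  | node s i ts c ih =>
    intro p hp
    obtain ⟨qs, hμ, hqs⟩ := exists_of_hmu_node_ne_zero hp
    obtain ⟨p₁, hrp, hp₁⟩ := ih (p := qs i) (by simpa using hqs i)
    obtain ⟨hdef, htarget⟩ := hcong s qs (Function.update qs i p₁) fun j => by
      rcases eq_or_ne j i with rfl | hj
      · simpa using hrp
      · simpa [hj] using hrefl (qs j)
    obtain ⟨p', hp'⟩ := hdef.1 ⟨p, hμ⟩
    refine ⟨p', htarget p p' hμ hp', hdet.hmu_node_ne_zero hp' fun j => ?_⟩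
    rcases eq_or_ne j i with rfl | hj
    · simpa using hp₁
    · simpa [hj] using hqs j

/-- Every congruence of a dwta `M` that respects `F` is
contained in the weak equivalence `∼_M`. -/
theorem congruence_subset_weakEquiv {Sig Q S : Type} {ar : Sig → ℕ}
    [Fintype Q] [Semifield S]
    (μ : ∀ s : Sig, (Fin (ar s) → Q) → Q → S) (F : Finset Q)
    (hdet : Deterministic μ)
    (r : Q → Q → Prop) (hequiv : Equivalence r)
    (hcong : IsCongruence μ r) (hresp : Respects r F) :
    ∀ q q' : Q, r q q' → WeakEquiv μ F q q' := by
  have key : ∀ {q q' : Q}, r q q' → ∀ c : Ctx Sig ar Q,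
      finReach μ F (c.subst (.state q)) → finReach μ F (c.subst (.state q')) := by
    rintro q q' hr c ⟨p, hpF, hp⟩
    obtain ⟨p', hrp, hp'⟩ := hcong.exists_hmu_subst_ne_zero hdet hequiv.refl hr c hp
    exact ⟨p', (hresp p p' hrp).1 hpF, hp'⟩
  exact fun q q' hr c => ⟨key hr c, key (hequiv.symm hr) c⟩

end WTA
end

section
/- Let M=(Q,Σ,μ,F) be a dwta over the commutative semifield S, let q ≡_M q' with witnessing factor s∈S∖{0}, and let c∈C_Σ(Q) be a common sign of life for q and q'. Then h_μ^{(2)}(c[q]) = s·h_μ^{(2)}(c[q']); in particular, if q is live then the factor s witnessing q ≡_M q' is unique. -/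
open scoped BigOperators Classical

namespace WTA

variable {Sig Q Q' S : Type} {ar : Sig → ℕ}

/-- In a deterministic wta, every tree reaches at most one state with nonzero weight. -/
theorem Deterministic.hmu_target_unique {Sig Q S : Type} {ar : Sig → ℕ}
    [Fintype Q] [CommSemiring S] {μ : ∀ s : Sig, (Fin (ar s) → Q) → Q → S}
    (hdet : Deterministic μ) (t : PTree Sig ar Q) :
    ∀ {p p' : Q}, hmu μ t p ≠ 0 → hmu μ t p' ≠ 0 → p = p' := by
  induction t with
  | state r =>
    intro p p' hp hp'
    simp only [hmu, ne_eq, ite_eq_right_iff, not_forall] at hp hp'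
    exact hp.choose.symm.trans hp'.choose
  | node σ ts ih =>
    intro p p' hp hp'
    rw [hmu] at hp hp'
    obtain ⟨qs, -, hqs⟩ := Finset.exists_ne_zero_of_sum_ne_zero hp
    obtain ⟨qs', -, hqs'⟩ := Finset.exists_ne_zero_of_sum_ne_zero hp'
    have factor_ne_zero {rs : Fin (ar σ) → Q} (h : ∏ i, hmu μ (ts i) (rs i) ≠ 0)
        (i : Fin (ar σ)) : hmu μ (ts i) (rs i) ≠ 0 :=
      fun hi => h (Finset.prod_eq_zero (Finset.mem_univ i) hi)
    obtain rfl : qs = qs' := funext fun i =>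
      ih i (factor_ne_zero (right_ne_zero_of_mul hqs) i)
        (factor_ne_zero (right_ne_zero_of_mul hqs') i)
    exact hdet σ qs p p' (left_ne_zero_of_mul hqs) (left_ne_zero_of_mul hqs')

/-- If a deterministic wta reaches the state `p` on `t`, every sum of the weights of `t` over a
set of states containing `p` equals the weight at `p`. -/
theorem Deterministic.sum_hmu_eq {Sig Q S : Type} {ar : Sig → ℕ}
    [Fintype Q] [CommSemiring S] {μ : ∀ s : Sig, (Fin (ar s) → Q) → Q → S}
    (hdet : Deterministic μ) {t : PTree Sig ar Q} {p : Q} (hp : hmu μ t p ≠ 0)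
    {A : Finset Q} (hpA : p ∈ A) : ∑ r ∈ A, hmu μ t r = hmu μ t p :=
  Finset.sum_eq_single_of_mem p hpA fun _ _ hne =>
    by_contra fun hr => hne (hdet.hmu_target_unique t hr hp)

theorem Deterministic.cweight_eq_tweight {Sig Q S : Type} {ar : Sig → ℕ}
    [Fintype Q] [CommSemiring S] {μ : ∀ s : Sig, (Fin (ar s) → Q) → Q → S}
    (hdet : Deterministic μ) {F : Finset Q} {t : PTree Sig ar Q} (ht : finReach μ F t) :
    cweight μ F t = tweight μ t := by
  obtain ⟨p, hpF, hp⟩ := ht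
  exact (hdet.sum_hmu_eq hp hpF).trans (hdet.sum_hmu_eq hp (Finset.mem_univ p)).symm

theorem Deterministic.cweight_ne_zero {Sig Q S : Type} {ar : Sig → ℕ}
    [Fintype Q] [CommSemiring S] {μ : ∀ s : Sig, (Fin (ar s) → Q) → Q → S}
    (hdet : Deterministic μ) {F : Finset Q} {t : PTree Sig ar Q} (ht : finReach μ F t) :
    cweight μ F t ≠ 0 := by
  obtain ⟨p, hpF, hp⟩ := ht
  exact (hdet.sum_hmu_eq hp hpF).trans_ne hp

/-- If `q ≡_M q'` with witnessing factor `s` and `c` is a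
common sign of life for `q` and `q'`, then `h_μ^{(2)}(c[q]) = s · h_μ^{(2)}(c[q'])`;
in particular, for live `q` the witnessing factor is unique. -/
theorem mnEquiv_factor_eq_and_unique {Sig Q S : Type} {ar : Sig → ℕ}
    [Fintype Q] [Semifield S]
    (μ : ∀ s : Sig, (Fin (ar s) → Q) → Q → S) (F : Finset Q)
    (hdet : Deterministic μ)
    (q q' : Q) (s : S) (hs : s ≠ 0)
    (hwit : ∀ c : Ctx Sig ar Q,
      cweight μ F (c.subst (.state q)) = s * cweight μ F (c.subst (.state q')))
    (c : Ctx Sig ar Q) (hcq : SignOfLife μ F c q) (hcq' : SignOfLife μ F c q') :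
    tweight μ (c.subst (.state q)) = s * tweight μ (c.subst (.state q')) ∧
    (Live μ F q → ∀ s' : S, s' ≠ 0 →
      (∀ c' : Ctx Sig ar Q,
        cweight μ F (c'.subst (.state q)) = s' * cweight μ F (c'.subst (.state q'))) →
      s' = s) := by
  refine ⟨?_, fun _ s' _ hwit' => ?_⟩
  · rw [← hdet.cweight_eq_tweight hcq, ← hdet.cweight_eq_tweight hcq']
    exact hwit c
  · exact mul_right_cancel₀ (hdet.cweight_ne_zero hcq') ((hwit' c).symm.trans (hwit c))

end WTA
end
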